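/- Let q > 1 be real and c > 0 real. For p ∈ ℕ and n ∈ ℤ set φ_o^p(n) = q^{2n} · ₁φ₁(q^{4p}; q^{−6}; q^{−4}, −c q^{4n−4p−6}) (a terminating sum, since (q^{4p};q^{−4})_j = 0 for j > p). Then for all r, s ∈ ℕ the family n ↦ φ_o^r(n) φ_o^s(n) q^{2n} / (−c q^{4n};q^{−4})_∞ is summable over ℤ and ∑_{n∈ℤ} φ_o^r(n) φ_o^s(n) q^{2n} / (−c q^{4n};q^{−4})_∞ = δ_{rs} · q^{4r} · [(q^{−4};q^{−4})_r (q^{−4};q^{−4})_∞ (−c q^{−6};q^{−4})_∞ (−q^{2} c^{−1};q^{−4})_∞] / [(q^{−6};q^{−4})_r (q^{−6};q^{−4})_∞ (−c;q^{−4})_∞ (−q^{−4} c^{−1};q^{−4})_∞]. -/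

import Mathlib

open scoped BigOperators

/-- The q-shifted factorial `(a;p)_n = ∏_{i=0}^{n-1} (1 - a p^i)`. -/
noncomputable def qPoch (a p : ℂ) (n : ℕ) : ℂ :=
  ∏ i ∈ Finset.range n, (1 - a * p ^ i)

/-- The infinite q-shifted factorial `(a;p)_∞ = ∏_{i=0}^∞ (1 - a p^i)`. -/
noncomputable def qPochInf (a p : ℂ) : ℂ :=
  ∏' i : ℕ, (1 - a * p ^ i)

/-- The basic hypergeometric series
`₁φ₁(a;c;p,z) = ∑_{j=0}^∞ ((a;p)_j / ((p;p)_j (c;p)_j)) (-1)^j p^(j(j-1)/2) z^j`. -/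
noncomputable def phi11 (a c p z : ℂ) : ℂ :=
  ∑' j : ℕ, qPoch a p j / (qPoch p p j * qPoch c p j) * (-1) ^ j *
    p ^ (j * (j - 1) / 2) * z ^ j

/-- The odd eigenfunctions `φ_o^p(n) = q^{2n} ₁φ₁(q^{4p}; q⁻⁶; q⁻⁴, -c q^{4n-4p-6})`. -/
noncomputable def phiO (q c : ℝ) (p : ℕ) (n : ℤ) : ℂ :=
  (q : ℂ) ^ (2 * n) *
    phi11 ((q : ℂ) ^ (4 * (p : ℤ))) ((q : ℂ) ^ (-6 : ℤ)) ((q : ℂ) ^ (-4 : ℤ))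
      (-(c : ℂ) * (q : ℂ) ^ (4 * n - 4 * (p : ℤ) - 6))

open Filter Topology

section QShifted

variable {Q : ℂ}

lemma qPoch_zero (a p : ℂ) : qPoch a p 0 = 1 := by simp [qPoch]

lemma qPoch_succ (a p : ℂ) (n : ℕ) : qPoch a p (n + 1) = qPoch a p n * (1 - a * p ^ n) := by
  simp [qPoch, Finset.prod_range_succ]

lemma qPoch_succ' (a p : ℂ) (n : ℕ) : qPoch a p (n + 1) = (1 - a) * qPoch (a * p) p n := by
  simp only [qPoch, Finset.prod_range_succ', pow_zero, mul_one]
  rw [mul_comm]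
  congr 1
  exact Finset.prod_congr rfl fun i _ => by ring

lemma qPoch_add (a p : ℂ) (m n : ℕ) : qPoch a p (m + n) = qPoch a p m * qPoch (a * p ^ m) p n := by
  simp only [qPoch, Finset.prod_range_add]
  congr 1
  exact Finset.prod_congr rfl fun i _ => by ring

lemma qPoch_ne_zero {a p : ℂ} (h : ∀ i : ℕ, 1 - a * p ^ i ≠ 0) (n : ℕ) : qPoch a p n ≠ 0 :=
  Finset.prod_ne_zero_iff.2 fun i _ => h i

lemma summable_norm_mul_pow (hQ : ‖Q‖ < 1) (a : ℂ) : Summable fun i : ℕ => ‖-(a * Q ^ i)‖ := by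
  simp only [norm_neg, norm_mul, norm_pow]
  exact (summable_geometric_of_lt_one (norm_nonneg _) hQ).mul_left _

lemma multipliable_qPochInf (hQ : ‖Q‖ < 1) (a : ℂ) : Multipliable fun i : ℕ => 1 - a * Q ^ i := by
  simpa only [sub_eq_add_neg] using multipliable_one_add_of_summable (summable_norm_mul_pow hQ a)

lemma qPochInf_ne_zero (hQ : ‖Q‖ < 1) {a : ℂ} (h : ∀ i : ℕ, 1 - a * Q ^ i ≠ 0) :
    qPochInf a Q ≠ 0 := by
  have := tprod_one_add_ne_zero_of_summable (f := fun i : ℕ => -(a * Q ^ i))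
    (by simpa only [sub_eq_add_neg] using h) (summable_norm_mul_pow hQ a)
  simpa only [qPochInf, sub_eq_add_neg] using this

lemma qPochInf_eq (hQ : ‖Q‖ < 1) (a : ℂ) (n : ℕ) :
    qPochInf a Q = qPoch a Q n * qPochInf (a * Q ^ n) Q := by
  have key : (fun i : ℕ => 1 - a * Q ^ (i + n)) = fun i : ℕ => 1 - a * Q ^ n * Q ^ i := by
    funext i; ring
  have h := Multipliable.prod_mul_tprod_nat_mul' (f := fun i : ℕ => 1 - a * Q ^ i) (k := n)
    (by rw [key]; exact multipliable_qPochInf hQ _)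
  rw [key] at h
  exact h.symm

lemma tendsto_qPoch (hQ : ‖Q‖ < 1) (a : ℂ) :
    Tendsto (qPoch a Q) atTop (𝓝 (qPochInf a Q)) :=
  (multipliable_qPochInf hQ a).tendsto_prod_tprod_nat

lemma one_sub_mul_pow_ne_zero (hQ : ‖Q‖ < 1) {z : ℂ} (hz : ‖z‖ < 1) (i : ℕ) :
    1 - z * Q ^ i ≠ 0 := by
  intro h
  have h1 : ‖z * Q ^ i‖ = 1 := by rw [← sub_eq_zero.1 h, norm_one]
  rw [norm_mul, norm_pow] at h1
  have : ‖Q‖ ^ i ≤ 1 := pow_le_one₀ (norm_nonneg _) hQ.le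
  nlinarith [norm_nonneg z]

lemma tendsto_qPochInf_mul_pow (hQ : ‖Q‖ < 1) :
    Tendsto (fun n : ℕ => qPochInf (Q * Q ^ n) Q) atTop (𝓝 1) := by
  have h0 := qPochInf_ne_zero hQ (one_sub_mul_pow_ne_zero hQ hQ)
  have h := (tendsto_const_nhds (x := qPochInf Q Q)).div (tendsto_qPoch hQ Q) h0
  rw [div_self h0] at h
  refine h.congr fun n => ?_
  simp only [Pi.div_apply]
  rw [div_eq_iff (qPoch_ne_zero (one_sub_mul_pow_ne_zero hQ hQ) n), mul_comm]
  exact qPochInf_eq hQ Q n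

lemma tendsto_const_mul_pow_zero (hQ : ‖Q‖ < 1) (a : ℂ) :
    Tendsto (fun n : ℕ => a * Q ^ n) atTop (𝓝 0) := by
  simpa using (tendsto_pow_atTop_nhds_zero_of_norm_lt_one hQ).const_mul a

lemma summable_qBinomial (hQ : ‖Q‖ < 1) {a z : ℂ} (ha : ∀ i : ℕ, 1 - a * Q ^ i ≠ 0)
    (hz0 : z ≠ 0) (hz : ‖z‖ < 1) :
    Summable fun m : ℕ => qPoch a Q m / qPoch Q Q m * z ^ m := by
  have hne := qPoch_ne_zero (one_sub_mul_pow_ne_zero hQ hQ)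
  have hlim : Tendsto (fun m : ℕ => ‖(1 - a * Q ^ m) / (1 - Q * Q ^ m) * z‖) atTop (𝓝 ‖z‖) := by
    have := (((tendsto_const_mul_pow_zero hQ a).const_sub 1).div
      ((tendsto_const_mul_pow_zero hQ Q).const_sub 1) (by simp)).mul_const z
    simpa using this.norm
  refine summable_of_ratio_test_tendsto_lt_one hz (Eventually.of_forall fun m => ?_)
    (hlim.congr fun m => ?_)
  · exact mul_ne_zero (div_ne_zero (qPoch_ne_zero ha m) (hne m)) (pow_ne_zero _ hz0)
  · have h1 := qPoch_ne_zero ha m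
    have h2 := hne m
    have h3 := one_sub_mul_pow_ne_zero hQ hQ m
    rw [← norm_div, qPoch_succ, qPoch_succ]
    congr 1
    field_simp
    ring

/-- The `q`-binomial theorem. -/
lemma hasSum_qBinomial (hQ0 : Q ≠ 0) (hQ : ‖Q‖ < 1) {a z : ℂ} (ha : ∀ i : ℕ, 1 - a * Q ^ i ≠ 0)
    (hz0 : z ≠ 0) (hz : ‖z‖ < 1) :
    HasSum (fun m : ℕ => qPoch a Q m / qPoch Q Q m * z ^ m)
      (qPochInf (a * z) Q / qPochInf z Q) := by
  have hne := qPoch_ne_zero (one_sub_mul_pow_ne_zero hQ hQ)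
  set u : ℕ → ℂ := fun m => qPoch a Q m / qPoch Q Q m with hu
  set f : ℂ → ℂ := fun y => ∑' m, u m * y ^ m with hf
  have hle : ∀ n : ℕ, ‖z * Q ^ n‖ ≤ ‖z‖ := fun n => by
    rw [norm_mul, norm_pow]
    exact mul_le_of_le_one_right (norm_nonneg _) (pow_le_one₀ (norm_nonneg _) hQ.le)
  have hsum : ∀ n : ℕ, HasSum (fun m => u m * (z * Q ^ n) ^ m) (f (z * Q ^ n)) := fun n =>
    (summable_qBinomial hQ ha (mul_ne_zero hz0 (pow_ne_zero _ hQ0))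
      ((hle n).trans_lt hz)).hasSum
  have hstep : ∀ n : ℕ, f (z * Q ^ n) * (1 - z * Q ^ n) =
      (1 - a * z * Q ^ n) * f (z * Q ^ (n + 1)) := by
    intro n
    have h1 := (hasSum_nat_add_iff' 1).2 ((hsum n).sub (hsum (n + 1)))
    have h2 := ((hsum n).sub ((hsum (n + 1)).mul_left a)).mul_left (z * Q ^ n)
    have h3 : (fun m => u (m + 1) * (z * Q ^ n) ^ (m + 1) -
        u (m + 1) * (z * Q ^ (n + 1)) ^ (m + 1)) =
        fun m => z * Q ^ n * (u m * (z * Q ^ n) ^ m - a * (u m * (z * Q ^ (n + 1)) ^ m)) := by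
      funext m
      have h4 : u (m + 1) * (1 - Q ^ (m + 1)) = u m * (1 - a * Q ^ m) := by
        have h5 := one_sub_mul_pow_ne_zero hQ hQ m
        have h6 := hne m
        simp only [hu, qPoch_succ]
        rw [← pow_succ'] at h5 ⊢
        field_simp
      have h7 : z * Q ^ (n + 1) = z * Q ^ n * Q := by ring
      rw [h7]
      generalize z * Q ^ n = y
      calc u (m + 1) * y ^ (m + 1) - u (m + 1) * (y * Q) ^ (m + 1)
          = u (m + 1) * (1 - Q ^ (m + 1)) * y ^ (m + 1) := by rw [mul_pow]; ring
        _ = _ := by rw [h4, mul_pow]; ring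
    rw [h3] at h1
    have h8 := h1.unique h2
    simp only [Finset.range_one, Finset.sum_singleton, pow_zero, sub_self, sub_zero] at h8
    linear_combination h8
  have hiter : ∀ n : ℕ, f z * qPoch z Q n = qPoch (a * z) Q n * f (z * Q ^ n) := by
    intro n
    induction n with
    | zero => simp [qPoch_zero]
    | succ n ih =>
      rw [qPoch_succ, qPoch_succ]
      linear_combination (1 - z * Q ^ n) * ih + qPoch (a * z) Q n * hstep n
  have hlim : Tendsto (fun n : ℕ => f (z * Q ^ n)) atTop (𝓝 1) := by
    have h0 : ∑' m : ℕ, (if m = 0 then (1 : ℂ) else 0) = 1 := tsum_ite_eq 0 _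
    rw [← h0]
    refine tendsto_tsum_of_dominated_convergence (bound := fun m => ‖u m * z ^ m‖)
      (summable_qBinomial hQ ha hz0 hz).norm (fun m => ?_) (Eventually.of_forall fun n m => ?_)
    · rcases m with _ | m
      · simp [hu, qPoch_zero]
      · simpa using ((tendsto_const_mul_pow_zero hQ z).pow (m + 1)).const_mul (u (m + 1))
    · rw [norm_mul, norm_mul, norm_pow, norm_pow]
      gcongr
      exact hle n
  have hfz : f z * qPochInf z Q = qPochInf (a * z) Q * 1 :=
    tendsto_nhds_unique ((tendsto_qPoch hQ z).const_mul (f z))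
      (((tendsto_qPoch hQ (a * z)).mul hlim).congr fun n => (hiter n).symm)
  have h := (summable_qBinomial hQ ha hz0 hz).hasSum
  rw [mul_one] at hfz
  rwa [← hfz, mul_div_cancel_right₀ _ (qPochInf_ne_zero hQ (one_sub_mul_pow_ne_zero hQ hz))]

lemma qPoch_mul_inv_pow (hQ0 : Q ≠ 0) {x : ℂ} (hx : x ≠ 0) (n : ℕ) :
    qPoch (x * (Q ^ n)⁻¹) Q n * Q ^ (n + 1).choose 2 = (-x) ^ n * qPoch (Q / x) Q n := by
  induction n with
  | zero => simp [qPoch_zero]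
  | succ n ih =>
    have h1 : x * (Q ^ (n + 1))⁻¹ * Q = x * (Q ^ n)⁻¹ := by
      rw [pow_succ]
      field_simp
    have h2 : (n + 1 + 1).choose 2 = (n + 1).choose 2 + (n + 1) := by
      rw [Nat.choose_succ_succ' (n + 1) 1, Nat.choose_one_right, add_comm]
    rw [qPoch_succ', h1, qPoch_succ (Q / x), h2, pow_add]
    have h3 : (1 - x * (Q ^ (n + 1))⁻¹) * Q ^ (n + 1) = -x * (1 - Q / x * Q ^ n) := by
      field_simp
      ring
    linear_combination (1 - x * (Q ^ (n + 1))⁻¹) * Q ^ (n + 1) * ih +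
      (-x) ^ n * qPoch (Q / x) Q n * h3

lemma qPoch_inv_pow_eq_zero (hQ0 : Q ≠ 0) {d n : ℕ} (h : d < n) : qPoch (Q ^ d)⁻¹ Q n = 0 :=
  Finset.prod_eq_zero (Finset.mem_range.2 h) (by
    rw [inv_mul_cancel₀ (pow_ne_zero _ hQ0), sub_self])

/-- The weight `1 / (-c Q^k; Q)_∞`. -/
noncomputable def qWeight (Q c : ℂ) (k : ℤ) : ℂ := (qPochInf (-c * Q ^ k) Q)⁻¹

variable {c : ℂ}

lemma one_sub_neg_mul_zpow_ne_zero (hQ0 : Q ≠ 0) (hc : ∀ k : ℤ, 1 + c * Q ^ k ≠ 0) (k : ℤ)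
    (i : ℕ) : 1 - -c * Q ^ k * Q ^ i ≠ 0 := by
  have := hc (k + i)
  rw [zpow_add₀ hQ0, zpow_natCast] at this
  convert this using 1
  ring

lemma qPochInf_neg_mul_zpow_ne_zero (hQ0 : Q ≠ 0) (hQ : ‖Q‖ < 1)
    (hc : ∀ k : ℤ, 1 + c * Q ^ k ≠ 0) (k : ℤ) : qPochInf (-c * Q ^ k) Q ≠ 0 :=
  qPochInf_ne_zero hQ (one_sub_neg_mul_zpow_ne_zero hQ0 hc k)

lemma qWeight_ne_zero (hQ0 : Q ≠ 0) (hQ : ‖Q‖ < 1) (hc : ∀ k : ℤ, 1 + c * Q ^ k ≠ 0) (k : ℤ) :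
    qWeight Q c k ≠ 0 :=
  inv_ne_zero (qPochInf_neg_mul_zpow_ne_zero hQ0 hQ hc k)

lemma qWeight_add_natCast (hQ0 : Q ≠ 0) (hQ : ‖Q‖ < 1) (hc : ∀ k : ℤ, 1 + c * Q ^ k ≠ 0)
    (k : ℤ) (m : ℕ) : qWeight Q c (k + m) = qPoch (-c * Q ^ k) Q m * qWeight Q c k := by
  have h := qPochInf_eq hQ (-c * Q ^ k) m
  have h1 : -c * Q ^ (k + m) = -c * Q ^ k * Q ^ m := by
    rw [zpow_add₀ hQ0, zpow_natCast, mul_assoc]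
  have h2 := qPochInf_neg_mul_zpow_ne_zero hQ0 hQ hc (k + m)
  have h3 := qPoch_ne_zero (one_sub_neg_mul_zpow_ne_zero hQ0 hc k) m
  rw [h1] at h2
  rw [qWeight, qWeight, h1, h, mul_inv, mul_inv_cancel_left₀ h3]

lemma qWeight_succ (hQ0 : Q ≠ 0) (hQ : ‖Q‖ < 1) (hc : ∀ k : ℤ, 1 + c * Q ^ k ≠ 0) (k : ℤ) :
    qWeight Q c (k + 1) = (1 + c * Q ^ k) * qWeight Q c k := by
  have := qWeight_add_natCast hQ0 hQ hc k 1
  rw [Nat.cast_one, qPoch_succ, qPoch_zero] at this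
  rw [this]
  ring

lemma summable_qWeight (hQ0 : Q ≠ 0) (hQ : ‖Q‖ < 1) (hc0 : c ≠ 0)
    (hc : ∀ k : ℤ, 1 + c * Q ^ k ≠ 0) {z : ℂ} (hz0 : z ≠ 0) (hz : ‖z‖ < 1) :
    Summable fun k : ℤ => qWeight Q c k * z ^ k := by
  have hne : ∀ k : ℤ, qWeight Q c k * z ^ k ≠ 0 := fun k =>
    mul_ne_zero (qWeight_ne_zero hQ0 hQ hc k) (zpow_ne_zero _ hz0)
  have hrec : ∀ k : ℤ, qWeight Q c (k + 1) * z ^ (k + 1) =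
      (1 + c * Q ^ k) * z * (qWeight Q c k * z ^ k) := fun k => by
    rw [qWeight_succ hQ0 hQ hc, zpow_add_one₀ hz0]
    ring
  refine Summable.of_nat_of_neg ?_ ?_
  · refine summable_of_ratio_test_tendsto_lt_one hz (Eventually.of_forall fun m => hne m) ?_
    have hlim : Tendsto (fun m : ℕ => ‖(1 + c * Q ^ m) * z‖) atTop (𝓝 ‖z‖) := by
      simpa using (((tendsto_const_mul_pow_zero hQ c).const_add 1).mul_const z).norm
    refine hlim.congr fun m => ?_
    rw [← norm_div, Nat.cast_succ, hrec, mul_div_cancel_right₀ _ (hne m), zpow_natCast]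
  · refine summable_of_ratio_test_tendsto_lt_one (l := 0) one_pos
      (Eventually.of_forall fun m => hne _) ?_
    have hlim : Tendsto (fun m : ℕ => ‖Q * Q ^ m / ((Q * Q ^ m + c) * z)‖) atTop (𝓝 0) := by
      have h1 := tendsto_const_mul_pow_zero hQ Q
      have := (h1.div ((h1.add_const c).mul_const z) (by simp [hc0, hz0])).norm
      simpa using this
    refine hlim.congr fun m => ?_
    have h1 := hrec (-((m + 1 : ℕ) : ℤ))
    have h2 : -((m + 1 : ℕ) : ℤ) + 1 = -(m : ℤ) := by push_cast; ring
    have h3 := hc (-((m + 1 : ℕ) : ℤ))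
    rw [h2] at h1
    rw [← norm_div, h1]
    have h4 := hne (-((m + 1 : ℕ) : ℤ))
    have h5 : c * Q ^ (-((m + 1 : ℕ) : ℤ)) = c / (Q * Q ^ m) := by
      rw [zpow_neg, zpow_natCast, pow_succ', div_eq_mul_inv]
    rw [h5] at h3 ⊢
    generalize qWeight Q c (-((m + 1 : ℕ) : ℤ)) * z ^ (-((m + 1 : ℕ) : ℤ)) = t at h4 ⊢
    have h6 : Q * Q ^ m ≠ 0 := mul_ne_zero hQ0 (pow_ne_zero _ hQ0)
    generalize Q * Q ^ m = y at h3 h6 ⊢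
    have h7 : y + c ≠ 0 := by
      intro h
      apply h3
      rw [← mul_right_inj' h6, mul_zero, mul_add, mul_one, mul_div_cancel₀ _ h6, h]
    congr 1
    field_simp

lemma qPochInf_mul_zpow_eq_zero (hQ0 : Q ≠ 0) (hQ : ‖Q‖ < 1) {j : ℤ} (hj : j < 0) :
    qPochInf (Q * Q ^ j) Q = 0 := by
  obtain ⟨i, rfl⟩ : ∃ i : ℕ, j = -(i : ℤ) - 1 := ⟨(-j - 1).toNat, by omega⟩
  have h : Q * Q ^ (-(i : ℤ) - 1) = (Q ^ i)⁻¹ := by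
    rw [zpow_sub_one₀ hQ0, zpow_neg, zpow_natCast]
    field_simp
  rw [h, qPochInf_eq hQ _ (i + 1), qPoch_inv_pow_eq_zero hQ0 (Nat.lt_succ_self i), zero_mul]

lemma exists_norm_qPochInf_mul_zpow_le (hQ0 : Q ≠ 0) (hQ : ‖Q‖ < 1) :
    ∃ M : ℝ, ∀ j : ℤ, ‖qPochInf (Q * Q ^ j) Q‖ ≤ M := by
  obtain ⟨M, hM⟩ := (tendsto_qPochInf_mul_pow hQ).norm.bddAbove_range
  have hM' : ∀ n : ℕ, ‖qPochInf (Q * Q ^ n) Q‖ ≤ M := fun n => hM ⟨n, rfl⟩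
  refine ⟨M, fun j => ?_⟩
  rcases lt_or_ge j 0 with hj | hj
  · rw [qPochInf_mul_zpow_eq_zero hQ0 hQ hj, norm_zero]
    exact (norm_nonneg _).trans (hM' 0)
  · lift j to ℕ using hj
    rw [zpow_natCast]
    exact hM' j

lemma hasSum_qWeight_truncated (hQ0 : Q ≠ 0) (hQ : ‖Q‖ < 1) (hc0 : c ≠ 0)
    (hc : ∀ k : ℤ, 1 + c * Q ^ k ≠ 0) {z : ℂ} (hz0 : z ≠ 0) (hz : ‖z‖ < 1) (n : ℕ) :
    HasSum (fun k : ℤ => qPochInf (Q * Q ^ ((n : ℤ) + k)) Q * (qWeight Q c k * z ^ k))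
      (qPochInf Q Q * qPochInf (-c * z) Q * qPoch (-Q / (c * z)) Q n /
        (qPochInf z Q * qPochInf (-c) Q * qPoch (-Q / c) Q n)) := by
  have hinj : Function.Injective fun m : ℕ => (m : ℤ) - n := fun _ _ h => by
    simpa using h
  rw [← hinj.hasSum_iff]
  · have hpow : Q ^ (-(n : ℤ)) = (Q ^ n)⁻¹ := by rw [zpow_neg, zpow_natCast]
    set A : ℂ := -c * Q ^ (-(n : ℤ)) with hA
    have hA' : ∀ i : ℕ, 1 - A * Q ^ i ≠ 0 := one_sub_neg_mul_zpow_ne_zero hQ0 hc _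
    have hsum := (hasSum_qBinomial hQ0 hQ hA' hz0 hz).mul_left
      ((z ^ n)⁻¹ * qPochInf Q Q * qWeight Q c (-(n : ℤ)))
    have hshift : ∀ {x : ℂ}, x ≠ 0 → qPochInf (-x * (Q ^ n)⁻¹) Q * Q ^ (n + 1).choose 2 =
        x ^ n * qPoch (-Q / x) Q n * qPochInf (-x) Q := by
      intro x hx
      have h := qPoch_mul_inv_pow hQ0 (neg_ne_zero.2 hx) n
      rw [qPochInf_eq hQ _ n, inv_mul_cancel_right₀ (pow_ne_zero _ hQ0)]
      rw [neg_neg, div_neg, ← neg_div] at h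
      linear_combination qPochInf (-x) Q * h
    have hterm : ((fun k : ℤ => qPochInf (Q * Q ^ ((n : ℤ) + k)) Q * (qWeight Q c k * z ^ k)) ∘
        fun m : ℕ => (m : ℤ) - n) = fun m : ℕ => (z ^ n)⁻¹ * qPochInf Q Q *
          qWeight Q c (-(n : ℤ)) * (qPoch A Q m / qPoch Q Q m * z ^ m) := by
      funext m
      have h1 : (m : ℤ) - n = -(n : ℤ) + m := by ring
      have h2 : (n : ℤ) + (-(n : ℤ) + m) = m := by ring
      have h3 := qPochInf_eq hQ Q m
      have h4 := qPoch_ne_zero (one_sub_mul_pow_ne_zero hQ hQ) m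
      simp only [Function.comp_apply]
      rw [h1, h2, qWeight_add_natCast hQ0 hQ hc, h3, zpow_add₀ hz0, zpow_neg z, zpow_natCast,
        zpow_natCast, zpow_natCast, ← hA]
      field_simp
    have h1 := hshift hc0
    have h2 := hshift (mul_ne_zero hc0 hz0)
    have h4 : qPochInf A Q ≠ 0 := qPochInf_ne_zero hQ hA'
    have h5 : qPochInf (-c) Q ≠ 0 := by
      simpa using qPochInf_neg_mul_zpow_ne_zero hQ0 hQ hc 0
    have h6 : qPochInf z Q ≠ 0 := qPochInf_ne_zero hQ (one_sub_mul_pow_ne_zero hQ hz)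
    have h7 : Q ^ (n + 1).choose 2 ≠ 0 := pow_ne_zero _ hQ0
    have h8 : A * z = -(c * z) * (Q ^ n)⁻¹ := by rw [hA, hpow]; ring
    have h9 : A = -c * (Q ^ n)⁻¹ := by rw [hA, hpow]
    rw [← h9] at h1
    rw [← h8] at h2
    have h10 : qPoch (-Q / c) Q n ≠ 0 := by
      intro h
      rw [h, mul_zero, zero_mul] at h1
      exact mul_ne_zero h4 h7 h1
    have hval : qPochInf Q Q * qPochInf (-c * z) Q * qPoch (-Q / (c * z)) Q n /
        (qPochInf z Q * qPochInf (-c) Q * qPoch (-Q / c) Q n) =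
        (z ^ n)⁻¹ * qPochInf Q Q * qWeight Q c (-(n : ℤ)) *
          (qPochInf (A * z) Q / qPochInf z Q) := by
      rw [qWeight, ← hA, neg_mul c z, eq_div_of_mul_eq h7 h1, eq_div_of_mul_eq h7 h2, mul_pow]
      field_simp
    rw [hterm, hval]
    exact hsum
  · intro k hk
    rw [qPochInf_mul_zpow_eq_zero hQ0 hQ, zero_mul]
    by_contra h
    exact hk ⟨((n : ℤ) + k).toNat, by simp only; omega⟩

/-- The case `b = 0` of Ramanujan's `₁ψ₁` summation. -/
lemma hasSum_qWeight (hQ0 : Q ≠ 0) (hQ : ‖Q‖ < 1) (hc0 : c ≠ 0)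
    (hc : ∀ k : ℤ, 1 + c * Q ^ k ≠ 0) {z : ℂ} (hz0 : z ≠ 0) (hz : ‖z‖ < 1) :
    HasSum (fun k : ℤ => qWeight Q c k * z ^ k)
      (qPochInf Q Q * qPochInf (-c * z) Q * qPochInf (-Q / (c * z)) Q /
        (qPochInf z Q * qPochInf (-c) Q * qPochInf (-Q / c) Q)) := by
  have hsum := summable_qWeight hQ0 hQ hc0 hc hz0 hz
  obtain ⟨M, hM⟩ := exists_norm_qPochInf_mul_zpow_le hQ0 hQ
  have hlim : Tendsto (fun n : ℕ => ∑' k : ℤ, qPochInf (Q * Q ^ ((n : ℤ) + k)) Q *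
      (qWeight Q c k * z ^ k)) atTop (𝓝 (∑' k : ℤ, qWeight Q c k * z ^ k)) := by
    refine tendsto_tsum_of_dominated_convergence
      (bound := fun k : ℤ => M * ‖qWeight Q c k * z ^ k‖) (hsum.norm.mul_left M)
      (fun k => ?_) (Eventually.of_forall fun n k => ?_)
    · have h1 : Tendsto (fun n : ℕ => ((n : ℤ) + k).toNat) atTop atTop :=
        tendsto_atTop_atTop.2 fun b => ⟨b + k.natAbs, fun n hn => by omega⟩
      have h2 := ((tendsto_qPochInf_mul_pow hQ).comp h1).mul_const (qWeight Q c k * z ^ k)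
      rw [one_mul] at h2
      refine h2.congr' ?_
      filter_upwards [eventually_ge_atTop k.natAbs] with n hn
      have h3 : (((n : ℤ) + k).toNat : ℤ) = (n : ℤ) + k := Int.toNat_of_nonneg (by omega)
      simp only [Function.comp_apply]
      rw [← zpow_natCast, h3]
    · rw [norm_mul]
      exact mul_le_mul_of_nonneg_right (hM _) (norm_nonneg _)
  have h5 : qPochInf (-c) Q ≠ 0 := by
    simpa using qPochInf_neg_mul_zpow_ne_zero hQ0 hQ hc 0
  have h6 : qPochInf z Q ≠ 0 := qPochInf_ne_zero hQ (one_sub_mul_pow_ne_zero hQ hz)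
  have h7 : qPochInf (-Q / c) Q ≠ 0 := by
    refine qPochInf_ne_zero hQ fun i h => hc (-((i : ℤ) + 1)) ?_
    rw [zpow_neg, zpow_add_one₀ hQ0, zpow_natCast]
    have : c + Q ^ i * Q = 0 := by
      field_simp at h
      linear_combination h
    field_simp
    linear_combination this
  have hlim' := (((tendsto_qPoch hQ (-Q / (c * z))).const_mul
    (qPochInf Q Q * qPochInf (-c * z) Q)).div ((tendsto_qPoch hQ (-Q / c)).const_mul
      (qPochInf z Q * qPochInf (-c) Q)) (mul_ne_zero (mul_ne_zero h6 h5) h7))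
  have heq := tendsto_nhds_unique hlim (hlim'.congr fun n =>
    (hasSum_qWeight_truncated hQ0 hQ hc0 hc hz0 hz n).tsum_eq.symm)
  rw [← heq]
  exact hsum.hasSum

/-- The moments of the `q`-Laguerre weight. -/
lemma hasSum_qWeight_moment (hQ0 : Q ≠ 0) (hQ : ‖Q‖ < 1) (hc0 : c ≠ 0)
    (hc : ∀ k : ℤ, 1 + c * Q ^ k ≠ 0) {a S : ℂ} (ha0 : a ≠ 0) (ha : ‖a‖ < 1)
    (hS : HasSum (fun k : ℤ => qWeight Q c k * a ^ k) S) (m : ℕ) :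
    HasSum (fun k : ℤ => (c * Q ^ k) ^ m * (qWeight Q c k * a ^ k))
      (S * qPoch a Q m / (a ^ m * Q ^ m.choose 2)) := by
  have hsm : ∀ m : ℕ, Summable fun k : ℤ => (c * Q ^ k) ^ m * (qWeight Q c k * a ^ k) := by
    intro m
    have hlt : ‖a * Q ^ m‖ < 1 := by
      rw [norm_mul, norm_pow]
      exact (mul_le_of_le_one_right (norm_nonneg _)
        (pow_le_one₀ (norm_nonneg _) hQ.le)).trans_lt ha
    refine ((summable_qWeight hQ0 hQ hc0 hc (mul_ne_zero ha0 (pow_ne_zero m hQ0)) hlt).mul_left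
      (c ^ m)).congr fun k => ?_
    rw [mul_zpow, mul_pow, ← zpow_natCast (Q ^ k), ← zpow_natCast Q m, ← zpow_mul, ← zpow_mul,
      mul_comm (m : ℤ) k]
    ring
  induction m with
  | zero => simpa [qPoch_zero] using hS
  | succ m ih =>
    have h1 := (Equiv.addRight (1 : ℤ)).hasSum_iff.2 ih
    have h2 := (ih.add (hsm (m + 1)).hasSum).mul_left (Q ^ m * a)
    have h3 := h1.unique (h2.congr_fun fun k => ?_)
    · have h4 : ∑' k : ℤ, (c * Q ^ k) ^ (m + 1) * (qWeight Q c k * a ^ k) =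
          S * qPoch a Q (m + 1) / (a ^ (m + 1) * Q ^ (m + 1).choose 2) := by
        have h5 : (m + 1).choose 2 = m.choose 2 + m := by
          rw [Nat.choose_succ_succ' m 1, Nat.choose_one_right, add_comm]
        rw [qPoch_succ, h5, pow_add, pow_succ]
        generalize ∑' k : ℤ, (c * Q ^ k) ^ (m + 1) * (qWeight Q c k * a ^ k) = t at h3 ⊢
        field_simp at h3 ⊢
        linear_combination -h3
      rw [← h4]
      exact (hsm (m + 1)).hasSum
    · simp only [Function.comp_apply, Equiv.coe_addRight]
      rw [qWeight_succ hQ0 hQ hc, zpow_add_one₀ ha0, zpow_add_one₀ hQ0]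
      ring

lemma qPoch_inv_pow_succ_div (hQ0 : Q ≠ 0) (hQ : ‖Q‖ < 1) (r j : ℕ) :
    qPoch (Q ^ (r + 1))⁻¹ Q (j + 1) / qPoch Q Q (j + 1) =
      qPoch (Q ^ r)⁻¹ Q (j + 1) / qPoch Q Q (j + 1) -
        (Q ^ (r + 1))⁻¹ * (qPoch (Q ^ r)⁻¹ Q j / qPoch Q Q j) := by
  have h1 : (Q ^ (r + 1))⁻¹ * Q = (Q ^ r)⁻¹ := by
    rw [pow_succ]
    field_simp
  have h2 := qPoch_ne_zero (one_sub_mul_pow_ne_zero hQ hQ) j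
  have h3 := one_sub_mul_pow_ne_zero hQ hQ j
  rw [qPoch_succ' (Q ^ (r + 1))⁻¹, h1, qPoch_succ (Q ^ r)⁻¹, qPoch_succ Q, ← h1]
  generalize (Q ^ (r + 1))⁻¹ = x
  field_simp
  ring

lemma sum_qPoch_inv_pow (hQ0 : Q ≠ 0) (hQ : ‖Q‖ < 1) (r : ℕ) (y : ℂ) :
    ∑ j ∈ Finset.range (r + 1), qPoch (Q ^ r)⁻¹ Q j / qPoch Q Q j * y ^ j =
      qPoch (y * (Q ^ r)⁻¹) Q r := by
  induction r with
  | zero => simp [qPoch_zero]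
  | succ r ih =>
    have h1 : y * (Q ^ (r + 1))⁻¹ * Q = y * (Q ^ r)⁻¹ := by
      rw [pow_succ]
      field_simp
    have h2 : ∑ j ∈ Finset.range (r + 1), qPoch (Q ^ r)⁻¹ Q (j + 1) / qPoch Q Q (j + 1) *
        y ^ (j + 1) + 1 = qPoch (y * (Q ^ r)⁻¹) Q r := by
      have h3 := Finset.sum_range_succ'
        (fun j => qPoch (Q ^ r)⁻¹ Q j / qPoch Q Q j * y ^ j) (r + 1)
      rw [Finset.sum_range_succ, ih, qPoch_inv_pow_eq_zero hQ0 (Nat.lt_succ_self r)] at h3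
      simp only [qPoch_zero] at h3
      linear_combination -h3
    rw [qPoch_succ', h1, Finset.sum_range_succ']
    simp only [qPoch_inv_pow_succ_div hQ0 hQ, sub_mul, Finset.sum_sub_distrib, qPoch_zero]
    have h4 : ∑ j ∈ Finset.range (r + 1), (Q ^ (r + 1))⁻¹ *
        (qPoch (Q ^ r)⁻¹ Q j / qPoch Q Q j) * y ^ (j + 1) =
        y * (Q ^ (r + 1))⁻¹ * qPoch (y * (Q ^ r)⁻¹) Q r := by
      rw [← ih, Finset.mul_sum]
      exact Finset.sum_congr rfl fun j _ => by ring
    rw [h4]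
    linear_combination h2

lemma sum_qPoch_inv_pow_mul_eval (hQ0 : Q ≠ 0) (hQ : ‖Q‖ < 1) {r m : ℕ} (hm : m ≤ r)
    {f : Polynomial ℂ} (hf : f.natDegree ≤ m) :
    ∑ j ∈ Finset.range (r + 1), qPoch (Q ^ r)⁻¹ Q j / qPoch Q Q j * (Q ^ (r - m)) ^ j *
      f.eval (Q ^ j) = if m = r then f.coeff 0 * qPoch (Q ^ r)⁻¹ Q r else 0 := by
  have h1 : ∀ i ∈ Finset.range (m + 1), ∑ j ∈ Finset.range (r + 1),
      qPoch (Q ^ r)⁻¹ Q j / qPoch Q Q j * (Q ^ (r - m)) ^ j * (f.coeff i * (Q ^ j) ^ i) =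
      f.coeff i * qPoch (Q ^ (m - i))⁻¹ Q r := by
    intro i hi
    have hi' : i ≤ m := Nat.lt_succ_iff.1 (Finset.mem_range.1 hi)
    have h2 : (Q ^ (m - i))⁻¹ = Q ^ (r - m + i) * (Q ^ r)⁻¹ := by
      have : r = (r - m + i) + (m - i) := by omega
      rw [eq_mul_inv_iff_mul_eq₀ (pow_ne_zero _ hQ0)]
      nth_rewrite 1 [this]
      rw [pow_add, mul_comm, mul_inv_cancel_right₀ (pow_ne_zero _ hQ0)]
    rw [h2, ← sum_qPoch_inv_pow hQ0 hQ, Finset.mul_sum]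
    refine Finset.sum_congr rfl fun j _ => ?_
    rw [pow_add, mul_pow, ← pow_mul Q i j, ← pow_mul Q j i, mul_comm j i]
    ring
  simp only [Polynomial.eval_eq_sum_range' (Nat.lt_succ_of_le hf), Finset.mul_sum]
  rw [Finset.sum_comm, Finset.sum_congr rfl h1, Finset.sum_eq_single 0]
  · split_ifs with h
    · rw [h, Nat.sub_zero]
    · rw [qPoch_inv_pow_eq_zero hQ0 (by omega), mul_zero]
  · intro i hi hi0
    rw [Finset.mem_range] at hi
    rw [qPoch_inv_pow_eq_zero hQ0 (by omega), mul_zero]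
  · simp

/-- The coefficient of `x^j` in the `q`-Laguerre polynomial of degree `r` that takes the value
`1` at `x = 0`. -/
noncomputable def qLaguerreCoeff (Q a : ℂ) (r j : ℕ) : ℂ :=
  qPoch (Q ^ r)⁻¹ Q j / (qPoch Q Q j * qPoch a Q j) * Q ^ j.choose 2 * (Q ^ r * a) ^ j

lemma sum_qLaguerreCoeff_mul_moment (hQ0 : Q ≠ 0) (hQ : ‖Q‖ < 1) {a : ℂ} (ha0 : a ≠ 0)
    (ha : ‖a‖ < 1) (S : ℂ) {r m : ℕ} (hm : m ≤ r) :
    ∑ j ∈ Finset.range (r + 1), qLaguerreCoeff Q a r j *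
      (S * qPoch a Q (j + m) / (a ^ (j + m) * Q ^ (j + m).choose 2)) =
      if m = r then S * qPoch (Q ^ r)⁻¹ Q r / (a ^ r * Q ^ r.choose 2) else 0 := by
  set f : Polynomial ℂ :=
    ∏ i ∈ Finset.range m, (1 - Polynomial.C (a * Q ^ i) * Polynomial.X) with hf
  have hdeg : f.natDegree ≤ m := by
    refine (Polynomial.natDegree_prod_le _ _).trans ((Finset.sum_le_card_nsmul _ _ 1 ?_).trans ?_)
    · intro i _
      compute_degree
    · simp
  have heval : ∀ j : ℕ, f.eval (Q ^ j) = qPoch (a * Q ^ j) Q m := by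
    intro j
    rw [hf, Polynomial.eval_prod]
    refine Finset.prod_congr rfl fun i _ => ?_
    simp only [Polynomial.eval_sub, Polynomial.eval_one, Polynomial.eval_mul, Polynomial.eval_C,
      Polynomial.eval_X]
    ring
  have hcoeff : f.coeff 0 = 1 := by
    rw [hf, Polynomial.coeff_zero_prod]
    simp
  have h := sum_qPoch_inv_pow_mul_eval hQ0 hQ hm hdeg
  rw [hcoeff, one_mul] at h
  have h1 : ∀ j ∈ Finset.range (r + 1), qLaguerreCoeff Q a r j *
      (S * qPoch a Q (j + m) / (a ^ (j + m) * Q ^ (j + m).choose 2)) =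
      S / (a ^ m * Q ^ m.choose 2) * (qPoch (Q ^ r)⁻¹ Q j / qPoch Q Q j * (Q ^ (r - m)) ^ j *
        f.eval (Q ^ j)) := by
    intro j _
    have h2 := qPoch_ne_zero (one_sub_mul_pow_ne_zero hQ ha) j
    have h3 : (Q ^ r) ^ j = (Q ^ (r - m)) ^ j * Q ^ (j * m) := by
      rw [mul_comm j m, pow_mul Q m j, ← mul_pow, ← pow_add, Nat.sub_add_cancel hm]
    have h4 : (j + m).choose 2 = j.choose 2 + m.choose 2 + j * m := by
      rw [Nat.add_choose_eq]
      simp [Finset.Nat.antidiagonal_succ]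
      ring
    rw [heval, qLaguerreCoeff, qPoch_add, mul_pow, h3, h4, pow_add, pow_add, pow_add]
    field_simp
  rw [Finset.sum_congr rfl h1, ← Finset.mul_sum, h]
  split_ifs with hmr
  · rw [hmr, div_mul_eq_mul_div]
  · rw [mul_zero]

/-- The `q`-Laguerre polynomial of degree `r`, normalized to take the value `1` at `x = 0`. -/
noncomputable def qLaguerre (Q a : ℂ) (r : ℕ) (x : ℂ) : ℂ :=
  ∑ j ∈ Finset.range (r + 1), qLaguerreCoeff Q a r j * x ^ j

lemma hasSum_qLaguerre_mul_qLaguerre_of_le (hQ0 : Q ≠ 0) (hQ : ‖Q‖ < 1) (hc0 : c ≠ 0)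
    (hc : ∀ k : ℤ, 1 + c * Q ^ k ≠ 0) {a S : ℂ} (ha0 : a ≠ 0) (ha : ‖a‖ < 1)
    (hS : HasSum (fun k : ℤ => qWeight Q c k * a ^ k) S) {r s : ℕ} (hsr : s ≤ r) :
    HasSum (fun k : ℤ => qLaguerre Q a r (c * Q ^ k) * qLaguerre Q a s (c * Q ^ k) *
        (qWeight Q c k * a ^ k))
      (if r = s then S * qPoch Q Q r / (Q ^ r * qPoch a Q r) else 0) := by
  have h1 : HasSum (fun k : ℤ => ∑ m ∈ Finset.range (s + 1), qLaguerreCoeff Q a s m *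
      ∑ j ∈ Finset.range (r + 1), qLaguerreCoeff Q a r j *
        ((c * Q ^ k) ^ (j + m) * (qWeight Q c k * a ^ k)))
      (∑ m ∈ Finset.range (s + 1), qLaguerreCoeff Q a s m *
        ∑ j ∈ Finset.range (r + 1), qLaguerreCoeff Q a r j *
          (S * qPoch a Q (j + m) / (a ^ (j + m) * Q ^ (j + m).choose 2))) :=
    hasSum_sum fun m _ => (hasSum_sum fun j _ =>
      (hasSum_qWeight_moment hQ0 hQ hc0 hc ha0 ha hS (j + m)).mul_left _).mul_left _
  have hval : (∑ m ∈ Finset.range (s + 1), qLaguerreCoeff Q a s m *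
        ∑ j ∈ Finset.range (r + 1), qLaguerreCoeff Q a r j *
          (S * qPoch a Q (j + m) / (a ^ (j + m) * Q ^ (j + m).choose 2))) =
      if r = s then S * qPoch Q Q r / (Q ^ r * qPoch a Q r) else 0 := by
    have h2 : ∀ m ∈ Finset.range (s + 1), qLaguerreCoeff Q a s m *
        ∑ j ∈ Finset.range (r + 1), qLaguerreCoeff Q a r j *
          (S * qPoch a Q (j + m) / (a ^ (j + m) * Q ^ (j + m).choose 2)) =
        if m = r then qLaguerreCoeff Q a s r *
          (S * qPoch (Q ^ r)⁻¹ Q r / (a ^ r * Q ^ r.choose 2)) else 0 := by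
      intro m hm
      rw [Finset.mem_range] at hm
      rw [sum_qLaguerreCoeff_mul_moment hQ0 hQ ha0 ha S (by omega)]
      split_ifs with h
      · rw [h]
      · rw [mul_zero]
    rw [Finset.sum_congr rfl h2, Finset.sum_ite_eq']
    by_cases h : r = s
    · subst h
      rw [if_pos (by simp), if_pos rfl, qLaguerreCoeff]
      have h3 := qPoch_mul_inv_pow hQ0 one_ne_zero r
      have h4 := qPoch_ne_zero (one_sub_mul_pow_ne_zero hQ hQ) r
      have h5 := qPoch_ne_zero (one_sub_mul_pow_ne_zero hQ ha) r
      have h6 : (Q ^ r) ^ r * Q ^ r = Q ^ (r + 1).choose 2 * Q ^ (r + 1).choose 2 := by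
        have h9 := Nat.add_one_mul_choose_eq r 1
        rw [Nat.choose_one_right] at h9
        rw [← pow_mul, ← pow_add, ← pow_add]
        congr 1
        linarith
      have h7 : ((-1 : ℂ) ^ r) ^ 2 = 1 := by rw [← pow_mul, mul_comm, pow_mul]; simp
      rw [one_mul, div_one] at h3
      rw [mul_pow]
      have h8 : qPoch (Q ^ r)⁻¹ Q r ^ 2 * ((Q ^ r) ^ r * Q ^ r) = qPoch Q Q r ^ 2 := by
        rw [h6]
        linear_combination (qPoch (Q ^ r)⁻¹ Q r * Q ^ (r + 1).choose 2 +
          (-1) ^ r * qPoch Q Q r) * h3 + qPoch Q Q r ^ 2 * h7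
      generalize (Q ^ r) ^ r = t at h8 ⊢
      generalize qPoch (Q ^ r)⁻¹ Q r = u at h8 ⊢
      field_simp
      linear_combination S * h8
    · rw [if_neg (by simp; omega), if_neg h]
  rw [← hval]
  refine h1.congr_fun fun k => ?_
  rw [qLaguerre, qLaguerre, mul_comm (∑ j ∈ _, _), Finset.sum_mul_sum, Finset.sum_mul]
  refine Finset.sum_congr rfl fun m _ => ?_
  rw [Finset.mul_sum, Finset.sum_mul]
  exact Finset.sum_congr rfl fun j _ => by ring

lemma hasSum_qLaguerre_mul_qLaguerre (hQ0 : Q ≠ 0) (hQ : ‖Q‖ < 1) (hc0 : c ≠ 0)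
    (hc : ∀ k : ℤ, 1 + c * Q ^ k ≠ 0) {a S : ℂ} (ha0 : a ≠ 0) (ha : ‖a‖ < 1)
    (hS : HasSum (fun k : ℤ => qWeight Q c k * a ^ k) S) (r s : ℕ) :
    HasSum (fun k : ℤ => qLaguerre Q a r (c * Q ^ k) * qLaguerre Q a s (c * Q ^ k) *
        (qWeight Q c k * a ^ k))
      (if r = s then S * qPoch Q Q r / (Q ^ r * qPoch a Q r) else 0) := by
  rcases le_total s r with h | h
  · exact hasSum_qLaguerre_mul_qLaguerre_of_le hQ0 hQ hc0 hc ha0 ha hS h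
  · have h1 := hasSum_qLaguerre_mul_qLaguerre_of_le hQ0 hQ hc0 hc ha0 ha hS h
    simp only [mul_comm (qLaguerre Q a s _)] at h1
    rcases eq_or_ne r s with rfl | hne
    · exact h1
    · rw [if_neg hne.symm] at h1
      rwa [if_neg hne]

end QShifted

lemma phi11_inv_pow {Q : ℂ} (hQ0 : Q ≠ 0) (a x : ℂ) (r : ℕ) :
    phi11 (Q ^ r)⁻¹ a Q (-(Q ^ r * a * x)) = qLaguerre Q a r x := by
  rw [phi11, qLaguerre, tsum_eq_sum (s := Finset.range (r + 1))]
  · refine Finset.sum_congr rfl fun j _ => ?_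
    have h : (-1 : ℂ) ^ j * (-1) ^ j = 1 := by rw [← mul_pow]; simp
    rw [qLaguerreCoeff, ← Nat.choose_two_right, neg_pow (Q ^ r * a * x), mul_pow _ x]
    linear_combination qPoch (Q ^ r)⁻¹ Q j / (qPoch Q Q j * qPoch a Q j) * Q ^ j.choose 2 *
      (Q ^ r * a) ^ j * x ^ j * h
  · intro j hj
    rw [Finset.mem_range] at hj
    rw [qPoch_inv_pow_eq_zero hQ0 (by omega)]
    simp

lemma phiO_eq_qLaguerre {q : ℝ} (hq : q ≠ 0) (c : ℝ) (r : ℕ) (n : ℤ) :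
    phiO q c r n = (q : ℂ) ^ (2 * n) *
      qLaguerre ((q : ℂ) ^ (-4 : ℤ)) ((q : ℂ) ^ (-6 : ℤ)) r (c * (q : ℂ) ^ (4 * n)) := by
  have hq' : (q : ℂ) ≠ 0 := Complex.ofReal_ne_zero.2 hq
  rw [phiO, ← phi11_inv_pow (zpow_ne_zero _ hq')]
  have h1 : (q : ℂ) ^ (4 * (r : ℤ)) = (((q : ℂ) ^ (-4 : ℤ)) ^ r)⁻¹ := by
    rw [← zpow_natCast, ← zpow_mul, ← zpow_neg]
    congr 1
    ring
  have h2 : (q : ℂ) ^ (4 * n - 4 * (r : ℤ) - 6) =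
      ((q : ℂ) ^ (-4 : ℤ)) ^ r * (q : ℂ) ^ (-6 : ℤ) * (q : ℂ) ^ (4 * n) := by
    rw [← zpow_natCast, ← zpow_mul, ← zpow_add₀ hq', ← zpow_add₀ hq']
    congr 1
    ring
  rw [h1, h2]
  congr 2
  ring

lemma norm_ofReal_zpow_lt_one {q : ℝ} (hq : 1 < q) {m : ℤ} (hm : m < 0) :
    ‖(q : ℂ) ^ m‖ < 1 := by
  rw [norm_zpow, Complex.norm_real, Real.norm_of_nonneg (by linarith)]
  exact zpow_lt_one_of_neg₀ hq hm

/-- Orthogonality of the odd eigenfunctions: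
`∑_{n∈ℤ} φ_o^r(n) φ_o^s(n) q^{2n} / (-c q^{4n};q⁻⁴)_∞
  = δ_{rs} q^{4r} (q⁻⁴;q⁻⁴)_r (q⁻⁴;q⁻⁴)_∞ (-cq⁻⁶;q⁻⁴)_∞ (-q²c⁻¹;q⁻⁴)_∞
      / ((q⁻⁶;q⁻⁴)_r (q⁻⁶;q⁻⁴)_∞ (-c;q⁻⁴)_∞ (-q⁻⁴c⁻¹;q⁻⁴)_∞)`,
the family being summable. -/
theorem phiO_orthogonality (q c : ℝ) (hq : 1 < q) (hc : 0 < c) (r s : ℕ) :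
    Summable (fun n : ℤ => phiO q c r n * phiO q c s n * (q : ℂ) ^ (2 * n) /
      qPochInf (-(c : ℂ) * (q : ℂ) ^ (4 * n)) ((q : ℂ) ^ (-4 : ℤ))) ∧
    ∑' n : ℤ, phiO q c r n * phiO q c s n * (q : ℂ) ^ (2 * n) /
        qPochInf (-(c : ℂ) * (q : ℂ) ^ (4 * n)) ((q : ℂ) ^ (-4 : ℤ)) =
      (if r = s then 1 else 0) * (q : ℂ) ^ (4 * (r : ℤ)) *
        (qPoch ((q : ℂ) ^ (-4 : ℤ)) ((q : ℂ) ^ (-4 : ℤ)) r *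
          qPochInf ((q : ℂ) ^ (-4 : ℤ)) ((q : ℂ) ^ (-4 : ℤ)) *
          qPochInf (-(c : ℂ) * (q : ℂ) ^ (-6 : ℤ)) ((q : ℂ) ^ (-4 : ℤ)) *
          qPochInf (-(q : ℂ) ^ (2 : ℤ) * (c : ℂ)⁻¹) ((q : ℂ) ^ (-4 : ℤ))) /
        (qPoch ((q : ℂ) ^ (-6 : ℤ)) ((q : ℂ) ^ (-4 : ℤ)) r *
          qPochInf ((q : ℂ) ^ (-6 : ℤ)) ((q : ℂ) ^ (-4 : ℤ)) *
          qPochInf (-(c : ℂ)) ((q : ℂ) ^ (-4 : ℤ)) *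
          qPochInf (-(q : ℂ) ^ (-4 : ℤ) * (c : ℂ)⁻¹) ((q : ℂ) ^ (-4 : ℤ))) := by
  have hq0 : q ≠ 0 := by linarith
  have hq' : (q : ℂ) ≠ 0 := Complex.ofReal_ne_zero.2 hq0
  have hc' : (c : ℂ) ≠ 0 := Complex.ofReal_ne_zero.2 hc.ne'
  set Q : ℂ := (q : ℂ) ^ (-4 : ℤ) with hQ
  set a : ℂ := (q : ℂ) ^ (-6 : ℤ) with ha
  have hQ0 : Q ≠ 0 := zpow_ne_zero _ hq'
  have ha0 : a ≠ 0 := zpow_ne_zero _ hq'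
  have hQ1 : ‖Q‖ < 1 := norm_ofReal_zpow_lt_one hq (by norm_num)
  have ha1 : ‖a‖ < 1 := norm_ofReal_zpow_lt_one hq (by norm_num)
  have hpole : ∀ k : ℤ, 1 + (c : ℂ) * Q ^ k ≠ 0 := by
    intro k
    have h : (0 : ℝ) < 1 + c * (q ^ (-4 : ℤ)) ^ k := by positivity
    rw [hQ]
    exact_mod_cast h.ne'
  have hpow : ∀ n : ℤ, (q : ℂ) ^ (4 * n) = Q ^ (-n) := by
    intro n
    rw [hQ, ← zpow_mul]
    congr 1
    ring
  have hmain := (Equiv.neg ℤ).hasSum_iff.2 (hasSum_qLaguerre_mul_qLaguerre hQ0 hQ1 hc' hpole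
    ha0 ha1 (hasSum_qWeight hQ0 hQ1 hc' hpole ha0 ha1) r s)
  have hterm : (fun n : ℤ => phiO q c r n * phiO q c s n * (q : ℂ) ^ (2 * n) /
      qPochInf (-(c : ℂ) * (q : ℂ) ^ (4 * n)) Q) =
      (fun k : ℤ => qLaguerre Q a r (c * Q ^ k) * qLaguerre Q a s (c * Q ^ k) *
        (qWeight Q c k * a ^ k)) ∘ Equiv.neg ℤ := by
    funext n
    have h : a ^ (-n) = (q : ℂ) ^ (2 * n) * (q : ℂ) ^ (2 * n) * (q : ℂ) ^ (2 * n) := by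
      rw [ha, ← zpow_mul, ← zpow_add₀ hq', ← zpow_add₀ hq']
      congr 1
      ring
    rw [phiO_eq_qLaguerre hq0, phiO_eq_qLaguerre hq0, ← hQ, ← ha, hpow]
    simp only [Function.comp_apply, Equiv.neg_apply]
    rw [h, qWeight, div_eq_mul_inv]
    ring
  rw [← hterm] at hmain
  refine ⟨hmain.summable, hmain.tsum_eq.trans ?_⟩
  by_cases hrs : r = s
  · rw [if_pos hrs, if_pos hrs]
    have h1 : (q : ℂ) ^ (4 * (r : ℤ)) = (Q ^ r)⁻¹ := by
      rw [hpow, zpow_neg, zpow_natCast]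
    have h2 : -(q : ℂ) ^ (2 : ℤ) * (c : ℂ)⁻¹ = -Q / (c * a) := by
      have h3 : (q : ℂ) ^ (2 : ℤ) * a = Q := by
        rw [ha, hQ, ← zpow_add₀ hq']
        norm_num
      rw [← h3]
      field_simp
    have h4 : -Q * (c : ℂ)⁻¹ = -Q / c := (div_eq_mul_inv _ _).symm
    rw [h1, h2, h4]
    ring
  · rw [if_neg hrs, if_neg hrs]
    simp
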